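/- arXiv:1105.3514 — 7 statements merged into one kernel-verified Lean document; each statement's English description precedes it below -/
import Mathlib

section
/- Let V be a finite nonempty vertex set, E a directed graph relation on V such that every vertex has at least one predecessor, τ ≥ 0, and H the map H(φ)(i) = min( φ(i) + τ , min_{j : E(j,i)} φ(j) ). Suppose v attains the minimum of φ. If there exists a directed walk of length exactly k from v to i (a sequence v = p₀, p₁, …, p_k = i with E(p_m, p_{m+1}) for all m), then the k-fold iterate satisfies H^k(φ)(i) = φ(v). -/
/-- A directed walk of length exactly `k` from `u` to `w` in the graph `E`. -/
def Walk {V : Type*} (E : V → V → Prop) (u w : V) (k : ℕ) : Prop :=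
  ∃ p : ℕ → V, p 0 = u ∧ p k = w ∧ ∀ m < k, E (p m) (p (m + 1))

/-- if `v` minimizes `φ` and there is a directed walk of length
exactly `k` from `v` to `i`, then `H^[k] φ i = φ v`. -/
theorem strong_resetting_min_spreads_along_walk
    {V : Type*} [Fintype V] [Nonempty V]
    (E : V → V → Prop) (hE : ∀ i, ∃ j, E j i)
    (τ : ℝ) (hτ : 0 ≤ τ)
    (H : (V → ℝ) → (V → ℝ))
    (hH : ∀ φ i, H φ i = min (φ i + τ) (sInf (φ '' {j | E j i})))
    (φ : V → ℝ) (v : V) (hv : φ v = ⨅ i, φ i)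
    (i : V) (k : ℕ) (hwalk : Walk E v i k) :
    H^[k] φ i = φ v := by
  have low : ∀ n j, φ v ≤ H^[n] φ j := by
    intro n
    induction n with
    | zero =>
      intro j
      rw [hv]
      exact ciInf_le (Set.finite_range φ).bddBelow j
    | succ n ih =>
      intro j
      rw [Function.iterate_succ_apply', hH]
      refine le_min (by linarith [ih j]) ?_
      obtain ⟨a, ha⟩ := hE j
      refine le_csInf ⟨_, a, ha, rfl⟩ ?_
      rintro _ ⟨b, _, rfl⟩
      exact ih b
  obtain ⟨p, h0, hk, hp⟩ := hwalk
  have key : ∀ n, n ≤ k → H^[n] φ (p n) = φ v := by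
    intro n
    induction n with
    | zero => intro _; simp [h0]
    | succ n ih =>
      intro hn
      refine le_antisymm ?_ (low _ _)
      rw [Function.iterate_succ_apply', hH]
      refine (min_le_right _ _).trans ?_
      rw [← ih (by omega)]
      exact csInf_le (Set.toFinite _).bddBelow ⟨p n, hp n (by omega), rfl⟩
  rw [← hk]
  exact key k le_rfl
end

section
/- Let V be a finite nonempty vertex set, E a directed graph relation on V such that every vertex has at least one predecessor, τ ≥ 0, and H the map H(φ)(i) = min( φ(i) + τ , min_{j : E(j,i)} φ(j) ). Suppose v attains the minimum of φ, and suppose d ≥ 0 is such that every vertex i ∈ V admits a directed walk of length exactly d from v to i. Then H^d(φ) is the constant function with value φ(v); moreover H^k(φ) is the constant function with value φ(v) for every k ≥ d. In particular the strong-resetting system synchronizes. -/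
/-- if `v` minimizes `φ` and every vertex admits a directed walk
of length exactly `d` from `v`, then `H^[k] φ` is the constant function `φ v`
for every `k ≥ d`: the strong-resetting system synchronizes. -/
theorem strong_resetting_synchronizes
    {V : Type*} [Fintype V] [Nonempty V]
    (E : V → V → Prop) (hE : ∀ i, ∃ j, E j i)
    (τ : ℝ) (hτ : 0 ≤ τ)
    (H : (V → ℝ) → (V → ℝ))
    (hH : ∀ φ i, H φ i = min (φ i + τ) (sInf (φ '' {j | E j i})))
    (φ : V → ℝ) (v : V) (hv : φ v = ⨅ i, φ i)
    (d : ℕ) (hd : ∀ i, Walk E v i d) :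
    ∀ k, d ≤ k → H^[k] φ = fun _ => φ v := by
  have hmin : ∀ i, φ v ≤ φ i := fun i => hv ▸ ciInf_le (Set.finite_range φ).bddBelow i
  have hup : ∀ (ψ : V → ℝ) (j i : V), E j i → H ψ i ≤ ψ j := by
    intro ψ j i hji
    rw [hH]
    exact (min_le_right _ _).trans
      (csInf_le ((Set.toFinite _).image ψ).bddBelow ⟨j, hji, rfl⟩)
  have hlow : ∀ (k : ℕ) (i : V), φ v ≤ H^[k] φ i := by
    intro k
    induction k with
    | zero => exact hmin
    | succ k ih =>
      intro i
      rw [Function.iterate_succ_apply', hH]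
      refine le_min (by linarith [ih i]) (le_csInf ?_ ?_)
      · obtain ⟨j, hj⟩ := hE i
        exact ⟨_, j, hj, rfl⟩
      · rintro _ ⟨j, -, rfl⟩
        exact ih j
  intro k hk
  induction k, hk using Nat.le_induction with
  | base =>
    funext i
    refine le_antisymm ?_ (hlow d i)
    obtain ⟨p, h0, h1, hp⟩ := hd i
    have key : ∀ m, m ≤ d → H^[m] φ (p m) ≤ φ v := by
      intro m
      induction m with
      | zero => intro _; simp [h0]
      | succ m ih =>
        intro hm
        rw [Function.iterate_succ_apply']
        exact (hup _ _ _ (hp m hm)).trans (ih (by omega))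
    exact h1 ▸ key d le_rfl
  | succ k hk ih =>
    funext i
    refine le_antisymm ?_ (hlow (k + 1) i)
    obtain ⟨j, hj⟩ := hE i
    rw [Function.iterate_succ_apply']
    exact (hup _ j i hj).trans (le_of_eq (congrFun ih j))
end

section
/- Let V be a finite nonempty vertex set, E a directed graph relation on V such that every vertex has at least one predecessor, τ ≥ 0, and H the map H(φ)(i) = min( φ(i) + τ , min_{j : E(j,i)} φ(j) ). Then for every k ≥ 0, every φ : V → ℝ and every i ∈ V: H^k(φ)(i) = min over all pairs (j, ℓ) with 0 ≤ ℓ ≤ k such that there is a directed walk of length exactly ℓ from j to i, of the quantity φ(j) + τ·(k − ℓ). -/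
/-- the `k`-th iterate of the strong-resetting pulse map is a
minimum over lazy walks: `H^[k] φ i` equals the minimum of `φ j + τ·(k − ℓ)`
over all pairs `(j, ℓ)` with `ℓ ≤ k` admitting a walk of length exactly `ℓ`
from `j` to `i`. -/
theorem strong_resetting_iterate_eq_min_over_lazy_walks
    {V : Type*} [Fintype V] [Nonempty V]
    (E : V → V → Prop) (hE : ∀ i, ∃ j, E j i)
    (τ : ℝ) (hτ : 0 ≤ τ)
    (H : (V → ℝ) → (V → ℝ))
    (hH : ∀ φ i, H φ i = min (φ i + τ) (sInf (φ '' {j | E j i})))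
    (k : ℕ) (φ : V → ℝ) (i : V) :
    H^[k] φ i =
      sInf {x : ℝ | ∃ j, ∃ ℓ ≤ k, Walk E j i ℓ ∧ x = φ j + τ * ((k - ℓ : ℕ) : ℝ)} := by
  have key : ∀ (k : ℕ) (i : V), IsLeast
      {x : ℝ | ∃ j, ∃ ℓ ≤ k, Walk E j i ℓ ∧ x = φ j + τ * ((k - ℓ : ℕ) : ℝ)} (H^[k] φ i) := by
    intro k
    induction k with
    | zero =>
      intro i
      refine ⟨⟨i, 0, le_rfl, ⟨fun _ => i, rfl, rfl, by simp⟩, by simp⟩, ?_⟩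
      rintro x ⟨j, l, hl, ⟨p, h0, h1, -⟩, rfl⟩
      obtain rfl : l = 0 := by omega
      subst h0
      subst h1
      simp
    | succ k ih =>
      intro i
      rw [Function.iterate_succ_apply', hH]
      have hfin : (H^[k] φ '' {j | E j i}).Finite := Set.toFinite _
      have hne : (H^[k] φ '' {j | E j i}).Nonempty := by
        obtain ⟨j, hj⟩ := hE i
        exact ⟨_, j, hj, rfl⟩
      constructor
      · rcases min_choice (H^[k] φ i + τ) (sInf (H^[k] φ '' {j | E j i})) with h | h
        · rw [h]
          obtain ⟨j, l, hl, hw, hx⟩ := (ih i).1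
          refine ⟨j, l, by omega, hw, ?_⟩
          rw [hx, Nat.succ_sub hl]
          push_cast
          ring
        · rw [h]
          obtain ⟨v, hv, hveq⟩ := hne.csInf_mem hfin
          obtain ⟨j, l, hl, ⟨p, h0, h1, hp⟩, hx⟩ := (ih v).1
          refine ⟨j, l + 1, by omega, ⟨fun m => if m ≤ l then p m else i, by simp [h0],
            by simp, ?_⟩, ?_⟩
          · intro m hm
            rcases Nat.lt_or_ge m l with hml | hml
            · have h2 : m ≤ l := by omega
              have h3 : m + 1 ≤ l := by omega
              simp only [h2, h3, if_true]
              exact hp m hml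
            · obtain rfl : m = l := by omega
              simpa [h1] using hv
          · rw [← hveq, hx, Nat.add_sub_add_right]
      · rintro x ⟨j, l, hl, hw, rfl⟩
        rcases Nat.lt_or_ge k l with hkl | hkl
        · obtain rfl : l = k + 1 := by omega
          obtain ⟨p, h0, h1, hp⟩ := hw
          have h2 := (ih (p k)).2 ⟨j, k, le_rfl, ⟨p, h0, rfl, fun m hm => hp m (by omega)⟩, rfl⟩
          have h3 : E (p k) i := h1 ▸ hp k (by omega)
          have h4 : sInf (H^[k] φ '' {j | E j i}) ≤ H^[k] φ (p k) :=
            csInf_le hfin.bddBelow ⟨p k, h3, rfl⟩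
          refine (min_le_right _ _).trans (h4.trans ?_)
          simpa using h2
        · have h2 := (ih i).2 ⟨j, l, hkl, hw, rfl⟩
          refine (min_le_left _ _).trans ?_
          rw [Nat.succ_sub hkl]
          push_cast
          push_cast at h2
          linarith
  exact (key k i).csInf_eq.symm
end

section
/- Let V be a finite nonempty vertex set, E a directed graph relation on V such that every vertex has at least one predecessor, τ ≥ 0, and H the map H(φ)(i) = min( φ(i) + τ , min_{j : E(j,i)} φ(j) ). If there is a directed walk of length exactly ℓ from j to i and k ≥ ℓ, then H^k(φ)(i) ≤ φ(j) + τ·(k − ℓ). -/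
/-- if there is a directed walk of length exactly `ℓ` from `j` to
`i` and `k ≥ ℓ`, then `H^[k] φ i ≤ φ j + τ·(k − ℓ)`. -/
theorem strong_resetting_iterate_le_of_walk
    {V : Type*} [Fintype V] [Nonempty V]
    (E : V → V → Prop) (hE : ∀ i, ∃ j, E j i)
    (τ : ℝ) (hτ : 0 ≤ τ)
    (H : (V → ℝ) → (V → ℝ))
    (hH : ∀ φ i, H φ i = min (φ i + τ) (sInf (φ '' {j | E j i})))
    (φ : V → ℝ) (j i : V) (ℓ k : ℕ)
    (hwalk : Walk E j i ℓ) (hk : ℓ ≤ k) :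
    H^[k] φ i ≤ φ j + τ * ((k - ℓ : ℕ) : ℝ) := by
  obtain ⟨p, rfl, rfl, hp⟩ := hwalk
  have h1 : ∀ n : ℕ, H^[n] φ (p 0) ≤ φ (p 0) + τ * (n : ℝ) := by
    intro n
    induction n with
    | zero => simp
    | succ n ih =>
      rw [Function.iterate_succ_apply', hH]
      refine (min_le_left _ _).trans ?_
      push_cast
      linarith
  have h2 : ∀ n m : ℕ, m ≤ ℓ → H^[n + m] φ (p m) ≤ φ (p 0) + τ * (n : ℝ) := by
    intro n m
    induction m with
    | zero => intro _; exact h1 n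
    | succ m ih =>
      intro hm
      rw [← add_assoc, Function.iterate_succ_apply', hH]
      refine (min_le_right _ _).trans (le_trans ?_ (ih (by omega)))
      exact csInf_le (Set.toFinite _).bddBelow ⟨p m, hp m (by omega), rfl⟩
  have h3 := h2 (k - ℓ) ℓ le_rfl
  rwa [Nat.sub_add_cancel hk] at h3
end

section
/- Let V be a finite nonempty vertex set and E a directed graph relation on V that is strongly connected (for all u, w there is a directed walk from u to w of some positive length) and aperiodic (the greatest common divisor of the lengths of all closed directed walks is 1). Then there exists N such that for every k ≥ N and every pair of vertices u, w there is a directed walk of length exactly k from u to w; equivalently, the d-fold successor map satisfies S^d(v) = V for all v and all d ≥ N. -/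
theorem Walk.append_aux {V : Type*} {E : V → V → Prop} {u v w : V} {a b : ℕ}
    (h₁ : Walk E u v a) (h₂ : Walk E v w b) : Walk E u w (a + b) := by
  obtain ⟨p, p0, pa, hp⟩ := h₁
  obtain ⟨q, q0, qb, hq⟩ := h₂
  refine ⟨fun m => if m < a then p m else q (m - a), ?_, ?_, ?_⟩
  · by_cases h : 0 < a
    · simp [h, p0]
    · have : a = 0 := by omega
      subst this
      simp [q0, ← pa, p0]
  · simp [qb]
  · intro m hm
    by_cases h : m + 1 < a
    · have h' : m < a := by omega
      simp only [h, h', if_true]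
      exact hp m h'
    · by_cases h' : m < a
      · have e : m + 1 = a := by omega
        simp only [h', e, if_true, lt_irrefl, if_false, Nat.sub_self, q0, ← pa]
        have := hp m h'
        rwa [e] at this
      · simp only [h, h', if_false]
        have := hq (m - a) (by omega)
        rwa [show m - a + 1 = m + 1 - a by omega] at this

/-- a strongly connected aperiodic finite digraph is primitive:
there exists `N` such that for every `k ≥ N` every ordered pair of vertices is
joined by a directed walk of length exactly `k` (equivalently `S^d(v) = V` for
all `v` and all `d ≥ N`).  Aperiodicity is expressed by saying that the only
common divisor of the lengths of all closed walks is `1`. -/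
theorem primitive_of_strongly_connected_aperiodic
    {V : Type*} [Fintype V] [Nonempty V]
    (E : V → V → Prop)
    (hconn : ∀ u w : V, ∃ k, 0 < k ∧ Walk E u w k)
    (haper : ∀ d : ℕ, (∀ k, 0 < k → (∃ u, Walk E u u k) → d ∣ k) → d = 1) :
    ∃ N : ℕ, ∀ k, N ≤ k → ∀ u w : V, Walk E u w k := by
  classical
  obtain ⟨v⟩ := ‹Nonempty V›
  let M : AddSubmonoid ℕ :=
    { carrier := {k | Walk E v v k}
      zero_mem' := ⟨fun _ => v, rfl, rfl, by intro m hm; omega⟩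
      add_mem' := fun h₁ h₂ => Walk.append_aux h₁ h₂ }
  have hM : ∀ k, k ∈ M ↔ Walk E v v k := fun k => Iff.rfl
  have hg : Nat.setGcd (M : Set ℕ) = 1 := by
    apply haper
    rintro k - ⟨u, hu⟩
    obtain ⟨a, -, ha⟩ := hconn v u
    obtain ⟨b, -, hb⟩ := hconn u v
    have h1 : Nat.setGcd (M : Set ℕ) ∣ a + b :=
      Nat.setGcd_dvd_of_mem ((hM _).2 (ha.append_aux hb))
    have h2 : Nat.setGcd (M : Set ℕ) ∣ a + k + b :=
      Nat.setGcd_dvd_of_mem ((hM _).2 ((ha.append_aux hu).append_aux hb))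
    rw [show a + k + b = (a + b) + k by ring] at h2
    exact (Nat.dvd_add_right h1).1 h2
  obtain ⟨n, hn⟩ : ∃ n, ∀ m ≥ n, m ∈ M := by
    obtain ⟨n, hn⟩ := Nat.exists_mem_closure_of_ge (M : Set ℕ)
    refine ⟨n, fun m hm => ?_⟩
    have := hn m hm (by rw [hg]; exact one_dvd m)
    rwa [AddSubmonoid.closure_eq] at this
  choose f _ hf using hconn
  refine ⟨n + ∑ u, f u v + ∑ w, f v w, fun k hk u w => ?_⟩
  have h1 : f u v ≤ ∑ u, f u v :=
    Finset.single_le_sum (f := fun u => f u v) (fun _ _ => Nat.zero_le _) (Finset.mem_univ u)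
  have h2 : f v w ≤ ∑ w, f v w :=
    Finset.single_le_sum (f := fun w => f v w) (fun _ _ => Nat.zero_le _) (Finset.mem_univ w)
  have h3 := (hM _).1 (hn (k - f u v - f v w) (by omega))
  have h4 := ((hf u v).append_aux h3).append_aux (hf v w)
  rwa [show f u v + (k - f u v - f v w) + f v w = k by omega] at h4
end

section
/- Let V be a finite nonempty vertex set, τ ≥ 0, and let E₁, E₂, …, E_d be a sequence of directed graph relations on V, each such that every vertex has at least one predecessor, with maps H_k(φ)(i) = min( φ(i) + τ , min_{j : E_k(j,i)} φ(j) ). Suppose v attains the minimum of φ : V → ℝ, and suppose the temporal successor sets T₀ = {v}, T_k = S_k(T_{k−1}) (where S_k(A) is the set of successors in E_k of vertices in A) satisfy T_d = V. Then (H_d ∘ ⋯ ∘ H_1)(φ) is the constant function with value φ(v). In particular the system synchronizes even though the graph changes at every step. -/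
/-- time-varying synchronization.  With graphs `E 0, …, E (d-1)`
applied in order (orbit `ψ`, `ψ 0 = φ`, `ψ (k+1) = H_k (ψ k)`), if `v`
minimizes `φ` and the temporal successor sets `T 0 = {v}`,
`T (k+1) = S_k (T k)` satisfy `T d = V`, then `(H_d ∘ ⋯ ∘ H_1) φ = ψ d` is the
constant function `φ v`: the system synchronizes even though the graph changes
at every step. -/
theorem strong_resetting_synchronizes_time_varying
    {V : Type*} [Fintype V] [Nonempty V]
    (τ : ℝ) (hτ : 0 ≤ τ) (d : ℕ)
    (E : ℕ → V → V → Prop) (hE : ∀ k < d, ∀ i, ∃ j, E k j i)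
    (φ : V → ℝ) (ψ : ℕ → V → ℝ)
    (hψ0 : ψ 0 = φ)
    (hψ : ∀ k < d, ∀ i, ψ (k + 1) i = min (ψ k i + τ) (sInf (ψ k '' {j | E k j i})))
    (v : V) (hv : φ v = ⨅ i, φ i)
    (T : ℕ → Set V)
    (hT0 : T 0 = {v})
    (hT : ∀ k < d, T (k + 1) = {i | ∃ j ∈ T k, E k j i})
    (hTd : T d = Set.univ) :
    ψ d = fun _ => φ v := by
  have key : ∀ k ≤ d, (∀ i, φ v ≤ ψ k i) ∧ ∀ i ∈ T k, ψ k i = φ v := by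
    intro k
    induction k with
    | zero =>
      intro _
      refine ⟨fun i => ?_, fun i hi => ?_⟩
      · rw [hψ0, hv]
        exact ciInf_le (Set.finite_range φ).bddBelow i
      · rw [hT0] at hi
        rw [hψ0, Set.mem_singleton_iff.mp hi]
    | succ k ih =>
      intro hk
      have hk' : k < d := hk
      obtain ⟨h1, h2⟩ := ih hk'.le
      have low : ∀ i, φ v ≤ ψ (k + 1) i := by
        intro i
        rw [hψ k hk' i]
        refine le_min (by linarith [h1 i]) (le_csInf ?_ ?_)
        · obtain ⟨j, hj⟩ := hE k hk' i
          exact ⟨_, j, hj, rfl⟩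
        · rintro _ ⟨j, _, rfl⟩
          exact h1 j
      refine ⟨low, fun i hi => le_antisymm ?_ (low i)⟩
      rw [hT k hk'] at hi
      obtain ⟨j, hj, hji⟩ := hi
      rw [hψ k hk' i, ← h2 j hj]
      exact (min_le_right _ _).trans
        (csInf_le (Set.toFinite _).bddBelow ⟨j, hji, rfl⟩)
  funext i
  exact (key d le_rfl).2 i (by rw [hTd]; trivial)
end

section
/- Let V be a finite nonempty vertex set, E a directed graph relation on V, τ > 0, and c : V → ℝ. Suppose λ : V → ℝ satisfies λ(i) = min( c(i) , min_{j : E(j,i)} (λ(j) + τ) ) for every i (with the inner minimum omitted when i has no predecessors). Then λ = L, where L(i) = min over all pairs (j, ℓ) such that there is a directed walk of length exactly ℓ from j to i, of c(j) + τ·ℓ. In particular the recursion has a unique solution. -/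
theorem walk_snoc {V : Type*} {E : V → V → Prop} {u v w : V} {k : ℕ}
    (h : Walk E u v k) (e : E v w) : Walk E u w (k + 1) := by
  obtain ⟨p, h0, hk, hs⟩ := h
  refine ⟨fun m => if m ≤ k then p m else w, by simp [h0], by simp, ?_⟩
  intro m hm
  rcases Nat.lt_or_ge m k with h | h
  · have h1 : m ≤ k := h.le
    have h2 : m + 1 ≤ k := h
    simp only [h1, h2, if_true]
    exact hs m h
  · obtain rfl : m = k := by omega
    simp [hk, e]

/-- uniqueness of the solution to the strong-firing Bellman
recursion: any `lam` satisfying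
`lam i = min (c i) (min_{j : E j i} (lam j + τ))` (inner minimum omitted when
`i` has no predecessors) equals
`L i = min { c j + τ·ℓ : walk of length ℓ from j to i }`. -/
theorem strong_firing_recursion_unique_solution
    {V : Type*} [Fintype V] [Nonempty V]
    (E : V → V → Prop)
    (τ : ℝ) (hτ : 0 < τ) (c : V → ℝ)
    (lam : V → ℝ)
    (hrec : ∀ i,
      ((∃ j, E j i) → lam i = min (c i) (sInf {x : ℝ | ∃ j, E j i ∧ x = lam j + τ})) ∧
      ((¬ ∃ j, E j i) → lam i = c i)) :
    ∀ i, lam i = sInf {x : ℝ | ∃ j ℓ, Walk E j i ℓ ∧ x = c j + τ * (ℓ : ℝ)} := by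
  have hfin : ∀ i, {x : ℝ | ∃ j, E j i ∧ x = lam j + τ}.Finite := by
    intro i
    refine (Set.finite_range (fun j => lam j + τ)).subset ?_
    rintro x ⟨j, -, rfl⟩
    exact ⟨j, rfl⟩
  have hA : ∀ i, lam i ≤ c i := by
    intro i
    by_cases h : ∃ j, E j i
    · rw [(hrec i).1 h]
      exact min_le_left _ _
    · exact ((hrec i).2 h).le
  have hB : ∀ i j, E j i → lam i ≤ lam j + τ := by
    intro i j h
    rw [(hrec i).1 ⟨j, h⟩]
    exact (min_le_right _ _).trans (csInf_le (hfin i).bddBelow ⟨j, h, rfl⟩)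
  have hC : ∀ i, lam i = c i ∨ ∃ j, E j i ∧ lam i = lam j + τ := by
    intro i
    by_cases h : ∃ j, E j i
    · have h1 := (hrec i).1 h
      obtain ⟨j, hj⟩ := h
      have hne : {x : ℝ | ∃ j, E j i ∧ x = lam j + τ}.Nonempty := ⟨_, j, hj, rfl⟩
      obtain ⟨j', hj', e⟩ := hne.csInf_mem (hfin i)
      rcases min_choice (c i) (sInf {x : ℝ | ∃ j, E j i ∧ x = lam j + τ}) with h2 | h2
      · exact Or.inl (h1.trans h2)
      · exact Or.inr ⟨j', hj', (h1.trans h2).trans e⟩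
    · exact Or.inl ((hrec i).2 h)
  have hL : ∀ i j ℓ, Walk E j i ℓ → lam i ≤ c j + τ * (ℓ : ℝ) := by
    rintro i j ℓ ⟨p, h0, hl, hs⟩
    have key : ∀ m : ℕ, m ≤ ℓ → lam (p m) ≤ c j + τ * (m : ℝ) := by
      intro m
      induction m with
      | zero => intro _; simpa [h0] using hA j
      | succ m ih =>
        intro hm
        have h1 := ih (by omega)
        have h2 := hB _ _ (hs m (by omega))
        push_cast
        linarith
    simpa [hl] using key ℓ le_rfl
  have hwf : WellFounded (fun a b : V => lam a < lam b) := by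
    haveI : IsTrans V (fun a b : V => lam a < lam b) := ⟨fun _ _ _ h1 h2 => h1.trans h2⟩
    haveI : Std.Irrefl (fun a b : V => lam a < lam b) := ⟨fun _ => lt_irrefl _⟩
    exact Finite.wellFounded_of_trans_of_irrefl _
  have hM : ∀ i, ∃ j ℓ, Walk E j i ℓ ∧ lam i = c j + τ * (ℓ : ℝ) := by
    intro i
    induction i using hwf.induction with
    | _ i ih =>
      rcases hC i with h | ⟨j, hj, h⟩
      · exact ⟨i, 0, ⟨fun _ => i, rfl, rfl, by simp⟩, by simpa using h⟩
      · obtain ⟨j', ℓ, hw, e⟩ := ih j (by linarith)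
        refine ⟨j', ℓ + 1, walk_snoc hw hj, ?_⟩
        push_cast
        linarith
  intro i
  have hleast : IsLeast {x : ℝ | ∃ j ℓ, Walk E j i ℓ ∧ x = c j + τ * (ℓ : ℝ)} (lam i) := by
    refine ⟨hM i, ?_⟩
    rintro x ⟨j, ℓ, hw, rfl⟩
    exact hL i j ℓ hw
  exact hleast.csInf_eq.symm
end
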